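/- arXiv:1409.0352 — 2 statements merged into one kernel-verified Lean document; each statement's English description precedes it below -/
import Mathlib

section
/- Let ψ : {3^n : n ∈ ℕ} → ℝ₊ be a non-increasing function such that x ↦ x² ψ(x) is non-increasing and tends to 0 as 3^n tends to infinity. Then for any c ∈ (0, 1/3), the set (𝒦(ψ) \ 𝒦(cψ)) ∩ 𝒞 is uncountable. -/
/-!
Setting: `𝔽₃((X⁻¹))`, the field of formal Laurent series over the field `𝔽₃` with `3` elements,
with absolute value `|f| = 3^N` when `f = ∑_{n ≥ -N} a_{-n} X^{-n}` with `a_N ≠ 0`, `|0| = 0`.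
We model it as `LaurentSeries (ZMod 3)` in the variable `t = X⁻¹`, so the coefficient
`a_{-n}` of `X^{-n}` is the coefficient of `t^n`, and `|f| = 3^{-ord_t f}`.
-/

noncomputable section
open scoped ENNReal Classical

instance : Fact (Nat.Prime 3) := ⟨by norm_num⟩

/-- The field with three elements. -/
abbrev F3 := ZMod 3

/-- The field `𝔽₃((X⁻¹))`, modelled as Laurent series in `t = X⁻¹`. -/
abbrev L3 := LaurentSeries F3

/-- The element `X`, i.e. `t⁻¹`. -/
def XL : L3 := HahnSeries.single (-1 : ℤ) 1

/-- The absolute value: `|f| = 3^{-ord_t f}` for `f ≠ 0` and `|0| = 0`. -/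
def absv (f : L3) : ℝ := if f = 0 then 0 else (3 : ℝ) ^ (-f.order)

/-- The ball of radius `r` around `x` for the ultrametric `d(x, y) = |x - y|`. -/
def ball (x : L3) (r : ℝ) : Set L3 := {y | absv (y - x) < r}

/-- The unit ball `𝕀 = {h : |h| < 1}` around `0`. -/
def unitBall : Set L3 := ball 0 1

/-- The Cantor set `𝒞`: elements of `𝕀` all of whose coefficients `a_{-n}` lie in `{0, 2}`. -/
def Cantor : Set L3 :=
  {f | (∀ m : ℤ, m ≤ 0 → f.coeff m = 0) ∧ ∀ m : ℤ, 1 ≤ m → f.coeff m = 0 ∨ f.coeff m = 2}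

/-- `γ = log 2 / log 3`. -/
def gam : ℝ := Real.log 2 / Real.log 3

/-- The Hausdorff `f`-measure of `A ⊆ 𝔽₃((X⁻¹))`, as defined in the paper:
`ℋ^f(A) = lim_{ρ → 0} inf ∑ᵢ f(r(Bᵢ))`, the infimum being over countable covers of `A`
by balls `Bᵢ` with radius `r(Bᵢ) ≤ ρ`.  Every ball has radius `3^k` for some `k ∈ ℤ`;
a ball is recorded as a pair (centre, k).  (The `⨆` over `ρ` is the limit `ρ → 0`, the inner
infimum being antitone in `ρ`.) -/
def hmeas (f : ℝ → ℝ) (A : Set L3) : ℝ≥0∞ :=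
  ⨆ (ρ : ℝ) (_ : 0 < ρ),
    ⨅ (S : Set (L3 × ℤ)) (_ : S.Countable)
      (_ : ∀ p ∈ S, (3 : ℝ) ^ p.2 ≤ ρ)
      (_ : A ⊆ ⋃ p ∈ S, ball p.1 ((3 : ℝ) ^ p.2)),
      ∑' p : S, ENNReal.ofReal (f ((3 : ℝ) ^ (p : L3 × ℤ).2))

/-- The Hausdorff `γ`-measure `ℋ^γ`. -/
def hgamma (A : Set L3) : ℝ≥0∞ := hmeas (fun r => r ^ gam) A

/-- `μ(A) = ℋ^γ(A ∩ 𝒞)`. -/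
def mu (A : Set L3) : ℝ≥0∞ := hgamma (A ∩ Cantor)

/-- A dimension function: a continuous, non-decreasing `f : ℝ_{≥0} → ℝ_{≥0}` with `f 0 = 0`. -/
structure IsDimFun (f : ℝ → ℝ) : Prop where
  mono : MonotoneOn f (Set.Ici 0)
  cont : ContinuousOn f (Set.Ici 0)
  zero : f 0 = 0
  nonneg : ∀ r, 0 ≤ r → 0 ≤ f r

/-- The image of a polynomial `g ∈ 𝔽₃[X]` in `𝔽₃((X⁻¹))`. -/
def toL (g : Polynomial F3) : L3 := Polynomial.aeval XL g

/-- `ℱ(N)`: polynomials over `𝔽₃` of degree `< N`, all of whose coefficients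
`a_0, …, a_{N-1}` lie in `{0, 2}`. -/
def Fset (N : ℕ) : Set (Polynomial F3) :=
  {g | g.degree < (N : ℕ) ∧ ∀ k < N, g.coeff k = 0 ∨ g.coeff k = 2}

/-- `ℱ*(N)`: members of `ℱ(N)` with `g(0) = 2`. -/
def FsetStar (N : ℕ) : Set (Polynomial F3) :=
  {g | g.degree < (N : ℕ) ∧ (∀ k < N, g.coeff k = 0 ∨ g.coeff k = 2) ∧ g.coeff 0 = 2}

/-- `W_𝒞(ψ)`: elements `h ∈ 𝒞` with `|h - g/X^N| < ψ(3^N)` for infinitely many `N ∈ ℕ`,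
where `g ∈ ℱ(N)`.  Here `ψ N` stands for `ψ(3^N)`. -/
def Wc (ψ : ℕ → ℝ) : Set L3 :=
  {h ∈ Cantor | ∀ m : ℕ, ∃ N : ℕ, m ≤ N ∧ 1 ≤ N ∧
    ∃ g ∈ Fset N, absv (h - toL g / XL ^ N) < ψ N}

/-- `W*_𝒞(ψ)`: defined like `W_𝒞(ψ)`, with `ℱ*(N)` in place of `ℱ(N)`. -/
def WcStar (ψ : ℕ → ℝ) : Set L3 :=
  {h ∈ Cantor | ∀ m : ℕ, ∃ N : ℕ, m ≤ N ∧ 1 ≤ N ∧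
    ∃ g ∈ FsetStar N, absv (h - toL g / XL ^ N) < ψ N}

/-- `A*_n = ⋃_{g ∈ ℱ*(n)} B(g/Xⁿ, ψ(3ⁿ))`. -/
def Astar (ψ : ℕ → ℝ) (n : ℕ) : Set L3 :=
  ⋃ g ∈ FsetStar n, ball (toL g / XL ^ n) (ψ n)

/-- `𝒦(ψ)`: elements `ξ ∈ 𝕀` with `|ξ - g/h| < ψ(|h|)` for infinitely many fractions
`g/h ∈ 𝔽₃(X)`.  Here `ψ d` stands for `ψ(3^d)`, and `|h| = 3^{deg h}`. -/
def Kset (ψ : ℕ → ℝ) : Set L3 :=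
  {ξ ∈ unitBall | {gh : Polynomial F3 × Polynomial F3 | gh.2 ≠ 0 ∧
    absv (ξ - toL gh.1 / toL gh.2) < ψ gh.2.natDegree}.Infinite}

/-- The irrationality exponent
`τ(ξ) = sup {τ : |ξ - g/h| < |h|^{-τ} for infinitely many g/h ∈ 𝔽₃(X)}`, valued in `[0, ∞]`. -/
def irrExp (ξ : L3) : ℝ≥0∞ :=
  sSup {t : ℝ≥0∞ | ∃ τ : ℝ, t = ENNReal.ofReal τ ∧
    {gh : Polynomial F3 × Polynomial F3 | gh.2 ≠ 0 ∧
      absv (ξ - toL gh.1 / toL gh.2) < absv (toL gh.2) ^ (-τ)}.Infinite}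

/-- The degree of a sum is that of a dominating first term. -/
lemma natDegree_X_pow_mul_add {u w : Polynomial F3} {e : ℕ} (hu : u ≠ 0) (hw : w.natDegree < e) :
    (Polynomial.X ^ e * u + w).natDegree = e + u.natDegree := by
  have h1 : (Polynomial.X ^ e * u).natDegree = e + u.natDegree := by
    rw [Polynomial.natDegree_mul (pow_ne_zero _ Polynomial.X_ne_zero) hu,
      Polynomial.natDegree_X_pow]
  rw [Polynomial.natDegree_add_eq_left_of_natDegree_lt (by omega), h1]

/-- A fraction `g / X ^ N` with `g(0) ≠ 0` is in lowest terms. -/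
lemma mul_sub_mul_X_pow_ne_zero {g p q : Polynomial F3} {N : ℕ} (hg : g.coeff 0 ≠ 0)
    (hq : q ≠ 0) (hqN : q.natDegree < N) : g * q - p * Polynomial.X ^ N ≠ 0 := by
  intro h
  have hcop : IsCoprime (Polynomial.X ^ N : Polynomial F3) g := by
    apply IsCoprime.pow_left
    rw [Polynomial.irreducible_X.coprime_iff_not_dvd, Polynomial.X_dvd_iff]
    exact hg
  have hdvd : (Polynomial.X ^ N : Polynomial F3) ∣ q :=
    hcop.dvd_of_dvd_mul_left ⟨p, by rw [sub_eq_zero.mp h, mul_comm]⟩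
  have := Polynomial.natDegree_le_of_dvd hdvd hq
  rw [Polynomial.natDegree_X_pow] at this
  omega

/-- `g / X ^ N` satisfies `|g / X ^ N - p / q| ≥ |q|⁻² 3 ^ (-D (deg q))` for all fractions `p / q`
with `deg q < N`. -/
def PoorlyApproximable (D : ℕ → ℕ) (N : ℕ) (g : Polynomial F3) : Prop :=
  ∀ p q : Polynomial F3, q ≠ 0 → q.natDegree < N →
    N ≤ (g * q - p * Polynomial.X ^ N).natDegree + q.natDegree + D q.natDegree

lemma PoorlyApproximable.of_le {D : ℕ → ℕ} {N : ℕ} (g : Polynomial F3) (h : ∀ m, N ≤ D m) :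
    PoorlyApproximable D N g := fun _ q _ _ => by
  have := h q.natDegree
  omega

/-- A folding step preserves poor approximability. -/
lemma PoorlyApproximable.fold {D : ℕ → ℕ} (hD : Monotone D) {N d : ℕ} {g : Polynomial F3}
    (hg : g.coeff 0 ≠ 0) (hd : 1 ≤ d) (hdD : d ≤ D N) (h : PoorlyApproximable D N g) :
    PoorlyApproximable D (2 * N + d) (g * Polynomial.X ^ (N + d) - 1) := by
  intro p q hq hqM
  set r := (g * Polynomial.X ^ (N + d) - 1) * q - p * Polynomial.X ^ (2 * N + d) with hr
  rcases lt_or_ge q.natDegree (N + d) with hm | hm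
  · have hr' : r = Polynomial.X ^ (N + d) * (g * q - p * Polynomial.X ^ N) + -q := by
      rw [hr]; ring
    by_cases hu : g * q - p * Polynomial.X ^ N = 0
    · have hrq : r.natDegree = q.natDegree := by
        rw [hr', hu, mul_zero, zero_add, Polynomial.natDegree_neg]
      have hNm : N ≤ q.natDegree := by
        by_contra hlt
        exact mul_sub_mul_X_pow_ne_zero hg hq (by omega) hu
      have := hD hNm
      omega
    · have hrd : r.natDegree = N + d + (g * q - p * Polynomial.X ^ N).natDegree := by
        rw [hr']
        exact natDegree_X_pow_mul_add hu (by rwa [Polynomial.natDegree_neg])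
      rcases lt_or_ge q.natDegree N with hmN | hmN
      · have := h p q hq hmN
        omega
      · omega
  · by_contra hlt
    have hs : r.natDegree < N := by omega
    have hr0 : r ≠ 0 := by
      apply mul_sub_mul_X_pow_ne_zero _ hq hqM
      have : (0 : ℕ) ≠ N + d := by omega
      simp [Polynomial.coeff_X_pow, this]
    set T := g ^ 2 * Polynomial.X ^ d * q - p * (g * Polynomial.X ^ (N + d) + 1) with hT
    have hq' : -q = Polynomial.X ^ (N + d) * (g * r - T * Polynomial.X ^ N) + r := by
      rw [hT, hr]; ring
    have hv := mul_sub_mul_X_pow_ne_zero (p := T) hg hr0 hs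
    have hdeg : q.natDegree = N + d + (g * r - T * Polynomial.X ^ N).natDegree := by
      rw [← Polynomial.natDegree_neg, hq']
      exact natDegree_X_pow_mul_add hv (by omega)
    have h1 := h T r hr0 hs
    have h2 : D r.natDegree ≤ D q.natDegree := hD (by omega)
    omega

lemma XL_ne_zero : XL ≠ 0 := HahnSeries.single_ne_zero one_ne_zero

lemma XL_pow (n : ℕ) : XL ^ n = HahnSeries.single (-(n : ℤ)) (1 : F3) := by
  rw [XL, HahnSeries.single_pow]
  simp

lemma toL_X : toL Polynomial.X = XL := Polynomial.aeval_X XL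

lemma toL_coeff_neg (p : Polynomial F3) (n : ℕ) : (toL p).coeff (-(n : ℤ)) = p.coeff n := by
  induction p using Polynomial.induction_on' with
  | add p q hp hq => simp only [toL, map_add] at *; simp [hp, hq]
  | monomial k a =>
    have hC : algebraMap F3 L3 = HahnSeries.C := Subsingleton.elim _ _
    rw [toL, Polynomial.aeval_monomial, XL_pow, Polynomial.coeff_monomial, hC,
      HahnSeries.C_mul_eq_smul, HahnSeries.coeff_smul, HahnSeries.coeff_single]
    simp [eq_comm]

lemma toL_coeff_of_lt (p : Polynomial F3) {i : ℤ} (hi : i < -(p.natDegree : ℤ)) :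
    (toL p).coeff i = 0 := by
  obtain ⟨n, rfl⟩ : ∃ n : ℕ, i = -(n : ℤ) := ⟨i.natAbs, by omega⟩
  rw [toL_coeff_neg]
  exact Polynomial.coeff_eq_zero_of_natDegree_lt (by omega)

lemma absv_zero : absv 0 = 0 := if_pos rfl

lemma absv_of_ne_zero {f : L3} (hf : f ≠ 0) : absv f = (3 : ℝ) ^ (-f.order) := if_neg hf

lemma absv_nonneg (f : L3) : 0 ≤ absv f := by
  unfold absv; split_ifs <;> positivity

lemma absv_eq_of_coeff {f : L3} {n : ℤ} (hn : f.coeff n ≠ 0) (hlt : ∀ i < n, f.coeff i = 0) :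
    absv f = (3 : ℝ) ^ (-n) := by
  have hf : f ≠ 0 := by rintro rfl; simp at hn
  have : f.order = n := by
    apply le_antisymm (HahnSeries.order_le_of_coeff_ne_zero hn)
    by_contra! h
    exact HahnSeries.coeff_order_eq_zero.not.mpr hf (hlt _ h)
  rw [absv_of_ne_zero hf, this]

lemma absv_toL {p : Polynomial F3} (hp : p ≠ 0) : absv (toL p) = (3 : ℝ) ^ p.natDegree := by
  rw [absv_eq_of_coeff (n := -(p.natDegree : ℤ)) _ fun i hi => toL_coeff_of_lt p hi]
  · simp
  · rw [toL_coeff_neg]; simpa using hp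

lemma toL_ne_zero {p : Polynomial F3} (hp : p ≠ 0) : toL p ≠ 0 := by
  intro h
  have := absv_toL hp
  rw [h, absv_zero] at this
  exact absurd this (by positivity)

lemma absv_XL_pow (n : ℕ) : absv (XL ^ n) = (3 : ℝ) ^ n := by
  rw [← toL_X, toL, ← map_pow]
  rw [← toL, absv_toL (pow_ne_zero _ Polynomial.X_ne_zero), Polynomial.natDegree_X_pow]

lemma absv_mul (f g : L3) : absv (f * g) = absv f * absv g := by
  by_cases hf : f = 0
  · simp [hf, absv_zero]
  by_cases hg : g = 0
  · simp [hg, absv_zero]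
  rw [absv_of_ne_zero hf, absv_of_ne_zero hg, absv_of_ne_zero (mul_ne_zero hf hg),
    HahnSeries.order_mul hf hg, neg_add, zpow_add₀ (by norm_num)]

lemma absv_neg (f : L3) : absv (-f) = absv f := by
  simp [absv, HahnSeries.order_neg]

lemma absv_add_le (f g : L3) : absv (f + g) ≤ max (absv f) (absv g) := by
  by_cases hf : f = 0
  · simp [hf]
  by_cases hg : g = 0
  · simp [hg]
  by_cases hfg : f + g = 0
  · rw [hfg, absv_zero]; exact le_max_of_le_left (absv_nonneg f)
  rw [absv_of_ne_zero hf, absv_of_ne_zero hg, absv_of_ne_zero hfg]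
  have := HahnSeries.min_order_le_order_add hfg
  rcases min_le_iff.mp this with h | h
  · exact le_max_of_le_left (zpow_le_zpow_right₀ (by norm_num) (by omega))
  · exact le_max_of_le_right (zpow_le_zpow_right₀ (by norm_num) (by omega))

lemma le_absv_sub_of_lt {ξ s x : L3} {r : ℝ} (hs : r ≤ absv (s - x)) (hξ : absv (ξ - s) < r) :
    r ≤ absv (ξ - x) := by
  have h := absv_add_le (ξ - x) (-(ξ - s))
  rw [absv_neg, show ξ - x + -(ξ - s) = s - x by ring] at h
  rcases le_max_iff.mp h with h | h <;> linarith

lemma PoorlyApproximable.le_absv {D : ℕ → ℕ} {N : ℕ} {g p q : Polynomial F3}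
    (h : PoorlyApproximable D N g) (hg : g.coeff 0 ≠ 0) (hq : q ≠ 0) (hqN : q.natDegree < N) :
    (3 : ℝ) ^ (-(2 * q.natDegree + D q.natDegree : ℕ) : ℤ) ≤
      absv (toL g / XL ^ N - toL p / toL q) := by
  have hq' := toL_ne_zero hq
  have hX := pow_ne_zero N XL_ne_zero
  have h0 : g * q - p * Polynomial.X ^ N ≠ 0 := mul_sub_mul_X_pow_ne_zero hg hq hqN
  have key : (toL g / XL ^ N - toL p / toL q) * (XL ^ N * toL q) =
      toL (g * q - p * Polynomial.X ^ N) := by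
    have : toL (g * q - p * Polynomial.X ^ N) = toL g * toL q - toL p * XL ^ N := by
      simp [toL]
    rw [this]
    field_simp
  have h1 := congrArg absv key
  rw [absv_mul, absv_mul, absv_XL_pow, absv_toL hq, absv_toL h0] at h1
  rw [← mul_le_mul_iff_left₀ (show (0 : ℝ) < 3 ^ N * 3 ^ q.natDegree by positivity), h1,
    ← pow_add, ← zpow_natCast, ← zpow_natCast, ← zpow_add₀ (by norm_num)]
  have := h p q hq hqN
  exact zpow_le_zpow_right₀ (by norm_num) (by push_cast; omega)

lemma finite_setOf_natDegree_le (n : ℕ) : {p : Polynomial F3 | p.natDegree ≤ n}.Finite := by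
  have : (Polynomial.degreeLT F3 (n + 1) : Set (Polynomial F3)).Finite := by
    have : Finite (Polynomial.degreeLT F3 (n + 1)) :=
      Finite.of_equiv _ (Polynomial.degreeLTEquiv F3 (n + 1)).toEquiv.symm
    exact Set.toFinite _
  refine this.subset fun p hp => ?_
  rw [SetLike.mem_coe, Polynomial.mem_degreeLT]
  exact lt_of_le_of_lt Polynomial.degree_le_natDegree (by exact_mod_cast Nat.lt_succ_of_le hp)

/-- The exponents `n₀, n₁, …` given by `n_{k+1} = 2 n_k + δ k n_k`. -/
def foldExp (n₀ : ℕ) (δ : ℕ → ℕ → ℕ) : ℕ → ℕ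
  | 0 => n₀
  | k + 1 => 2 * foldExp n₀ δ k + δ k (foldExp n₀ δ k)

/-- The numerators of the partial sums of `∑ 2 X ^ (-n_k)` over the denominators `X ^ n_k`. -/
def foldNum (n₀ : ℕ) (δ : ℕ → ℕ → ℕ) : ℕ → Polynomial F3
  | 0 => -1
  | k + 1 => foldNum n₀ δ k * Polynomial.X ^ (foldExp n₀ δ k + δ k (foldExp n₀ δ k)) - 1

/-- The Laurent series `∑ 2 X ^ (-n)`, over `n` in the range of `e`. -/
def indicatorSeries (e : ℕ → ℕ) : L3 :=
  HahnSeries.ofPowerSeries ℤ F3 (PowerSeries.mk fun m => if ∃ k, e k = m then 2 else 0)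

lemma indicatorSeries_coeff (e : ℕ → ℕ) (m : ℕ) :
    (indicatorSeries e).coeff (m : ℤ) = if ∃ k, e k = m then 2 else 0 := by
  rw [indicatorSeries, LaurentSeries.coeff_coe_powerSeries, PowerSeries.coeff_mk]

lemma indicatorSeries_coeff_of_neg (e : ℕ → ℕ) {i : ℤ} (hi : i < 0) :
    (indicatorSeries e).coeff i = 0 := by
  rw [indicatorSeries, PowerSeries.coeff_coe, if_pos hi]

lemma indicatorSeries_mem_Cantor {e : ℕ → ℕ} (he : ∀ k, 1 ≤ e k) :
    indicatorSeries e ∈ Cantor := by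
  refine ⟨fun m hm => ?_, fun m hm => ?_⟩
  · rcases hm.lt_or_eq with hm | rfl
    · exact indicatorSeries_coeff_of_neg e hm
    · have := indicatorSeries_coeff e 0
      rw [if_neg (by rintro ⟨k, hk⟩; have := he k; omega)] at this
      simpa using this
  · lift m to ℕ using by omega
    rw [indicatorSeries_coeff]
    split_ifs <;> simp

lemma Cantor_subset_unitBall : Cantor ⊆ unitBall := by
  intro f hf
  change absv (f - 0) < 1
  rw [sub_zero]
  by_cases h : f = 0
  · simp [h, absv_zero]
  rw [absv_of_ne_zero h]
  apply zpow_lt_one_of_neg₀ (by norm_num)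
  by_contra! h'
  exact HahnSeries.coeff_order_eq_zero.not.mpr h (hf.1 _ (by omega))

lemma indicatorSeries_injOn :
    Set.InjOn indicatorSeries {e | StrictMono e} := by
  intro e he f hf h
  apply (StrictMono.range_inj he hf).mp
  ext m
  have := congrArg (fun s : L3 => s.coeff (m : ℤ)) h
  simp only [indicatorSeries_coeff] at this
  have h2 : (2 : F3) ≠ 0 := by decide
  simp only [Set.mem_range]
  split_ifs at this with h3 h4 h4 <;> simp_all

section Fold

variable {n₀ : ℕ} {δ : ℕ → ℕ → ℕ}

lemma strictMono_foldExp (h₀ : 1 ≤ n₀) : StrictMono (foldExp n₀ δ) := by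
  have hpos : ∀ k, 1 ≤ foldExp n₀ δ k := by
    intro k
    induction k with
    | zero => exact h₀
    | succ k ih => rw [foldExp]; omega
  refine strictMono_nat_of_lt_succ fun k => ?_
  have := hpos k
  rw [foldExp]; omega

lemma le_foldExp (h₀ : 1 ≤ n₀) (k : ℕ) : n₀ ≤ foldExp n₀ δ k :=
  (strictMono_foldExp h₀).monotone (Nat.zero_le k)

lemma foldNum_coeff_zero (h₀ : 1 ≤ n₀) (k : ℕ) : (foldNum n₀ δ k).coeff 0 ≠ 0 := by
  cases k with
  | zero => simp [foldNum]
  | succ k =>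
    have : (0 : ℕ) ≠ foldExp n₀ δ k + δ k (foldExp n₀ δ k) := by
      have := le_foldExp (δ := δ) h₀ k
      omega
    simp [foldNum, Polynomial.coeff_X_pow, this]

lemma poorlyApproximable_foldNum {D : ℕ → ℕ} (hD : Monotone D) (h₀ : 1 ≤ n₀)
    (hDn : ∀ m, n₀ ≤ D m) (hδ : ∀ k n, n₀ ≤ n → 1 ≤ δ k n ∧ δ k n ≤ D n) (k : ℕ) :
    PoorlyApproximable D (foldExp n₀ δ k) (foldNum n₀ δ k) := by
  induction k with
  | zero => exact PoorlyApproximable.of_le _ hDn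
  | succ k ih =>
    have := hδ k _ (le_foldExp (δ := δ) h₀ k)
    exact ih.fold hD (foldNum_coeff_zero h₀ k) this.1 this.2

lemma foldNum_div (k : ℕ) : toL (foldNum n₀ δ k) / XL ^ foldExp n₀ δ k =
    ∑ j ∈ Finset.range (k + 1), HahnSeries.single (foldExp n₀ δ j : ℤ) (2 : F3) := by
  have hinv : ∀ n : ℕ, -(XL ^ n)⁻¹ = HahnSeries.single (n : ℤ) (2 : F3) := by
    intro n
    have h : HahnSeries.single (n : ℤ) (2 : F3) * XL ^ n = -1 := by
      rw [XL_pow, HahnSeries.single_mul_single, add_neg_cancel, mul_one,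
        show (2 : F3) = -1 by decide, HahnSeries.single_neg, HahnSeries.single_zero_one]
    rw [(eq_mul_inv_iff_mul_eq₀ (pow_ne_zero n XL_ne_zero)).mpr h, neg_one_mul]
  induction k with
  | zero =>
    rw [Finset.sum_range_one, ← hinv, foldNum, toL]
    simp [div_eq_mul_inv]
  | succ k ih =>
    rw [Finset.sum_range_succ, ← ih, ← hinv]
    have hX := XL_ne_zero
    have : toL (foldNum n₀ δ (k + 1)) =
        toL (foldNum n₀ δ k) * XL ^ (foldExp n₀ δ k + δ k (foldExp n₀ δ k)) - 1 := by
      simp [toL, foldNum]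
    rw [this, sub_div, ← sub_eq_add_neg, one_div, foldExp]
    congr 1
    rw [div_eq_div_iff (pow_ne_zero _ hX) (pow_ne_zero _ hX)]
    ring

lemma absv_indicatorSeries_sub (h₀ : 1 ≤ n₀) (k : ℕ) :
    absv (indicatorSeries (foldExp n₀ δ) - toL (foldNum n₀ δ k) / XL ^ foldExp n₀ δ k) =
      (3 : ℝ) ^ (-(foldExp n₀ δ (k + 1) : ℤ)) := by
  have hmono := strictMono_foldExp (δ := δ) h₀
  have hsum : ∀ i : ℤ, (∑ j ∈ Finset.range (k + 1),
      HahnSeries.single (foldExp n₀ δ j : ℤ) (2 : F3)).coeff i =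
      if ∃ j < k + 1, (foldExp n₀ δ j : ℤ) = i then 2 else 0 := by
    intro i
    rw [HahnSeries.coeff_sum]
    simp only [HahnSeries.coeff_single]
    split_ifs with h
    · obtain ⟨j, hj, rfl⟩ := h
      rw [Finset.sum_eq_single_of_mem j (Finset.mem_range.mpr hj), if_pos rfl]
      intro l _ hl
      rw [if_neg]
      intro h
      exact hl (hmono.injective (by exact_mod_cast h.symm))
    · apply Finset.sum_eq_zero
      intro j hj
      rw [if_neg]
      intro hi
      exact h ⟨j, Finset.mem_range.mp hj, hi.symm⟩
  rw [foldNum_div]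
  apply absv_eq_of_coeff
  · rw [HahnSeries.coeff_sub, hsum, indicatorSeries_coeff, if_pos ⟨_, rfl⟩, if_neg]
    · decide
    · rintro ⟨j, hj, h⟩
      have := hmono.injective (by exact_mod_cast h : foldExp n₀ δ j = foldExp n₀ δ (k + 1))
      omega
  · intro i hi
    rw [HahnSeries.coeff_sub, hsum]
    rcases lt_or_ge i 0 with hi0 | hi0
    · rw [indicatorSeries_coeff_of_neg _ hi0, if_neg (by rintro ⟨j, -, h⟩; omega), sub_zero]
    · lift i to ℕ using hi0
      rw [indicatorSeries_coeff, sub_eq_zero]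
      congr 1
      apply propext
      constructor
      · rintro ⟨j, rfl⟩
        exact ⟨j, hmono.lt_iff_lt.mp (by exact_mod_cast hi), rfl⟩
      · rintro ⟨j, -, h⟩
        exact ⟨j, by exact_mod_cast h⟩

lemma le_absv_indicatorSeries_sub {D : ℕ → ℕ} (hD : Monotone D) (h₀ : 1 ≤ n₀)
    (hDn : ∀ m, n₀ ≤ D m) (hδ : ∀ k n, n₀ ≤ n → 1 ≤ δ k n ∧ δ k n ≤ D n)
    (p : Polynomial F3) {q : Polynomial F3} (hq : q ≠ 0) :
    (3 : ℝ) ^ (-(2 * q.natDegree + D q.natDegree : ℕ) : ℤ) ≤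
      absv (indicatorSeries (foldExp n₀ δ) - toL p / toL q) := by
  have hmono := strictMono_foldExp (δ := δ) h₀
  set k := 2 * q.natDegree + D q.natDegree with hk
  have hDpos := hDn q.natDegree
  have hlt : k < foldExp n₀ δ (k + 1) := hmono.le_apply
  refine le_absv_sub_of_lt
    ((poorlyApproximable_foldNum hD h₀ hDn hδ k).le_absv (foldNum_coeff_zero h₀ k) hq ?_) ?_
  · have : k ≤ foldExp n₀ δ k := hmono.le_apply
    omega
  · rw [absv_indicatorSeries_sub h₀]
    exact zpow_lt_zpow_right₀ (by norm_num) (by omega)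

end Fold

/-- The least `d` with `3 ^ (-d) < φ n`. -/
def gapExp (φ : ℕ → ℝ) (n : ℕ) : ℕ := sInf {d : ℕ | (1 / 3 : ℝ) ^ d < φ n}

lemma gapExp_spec {φ : ℕ → ℝ} {n : ℕ} (h : 0 < φ n) : (1 / 3 : ℝ) ^ gapExp φ n < φ n :=
  Nat.sInf_mem (s := {d : ℕ | (1 / 3 : ℝ) ^ d < φ n})
    (exists_pow_lt_of_lt_one h (by norm_num))

lemma le_pow_of_lt_gapExp {φ : ℕ → ℝ} {n d : ℕ} (h : d < gapExp φ n) : φ n ≤ (1 / 3 : ℝ) ^ d :=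
  not_lt.mp (Nat.notMem_of_lt_sInf h)

lemma monotone_gapExp {φ : ℕ → ℝ} (hpos : ∀ n, 0 < φ n) (hφ : Antitone φ) :
    Monotone (gapExp φ) :=
  fun _ n hmn => Nat.sInf_le ((gapExp_spec (hpos n)).trans_le (hφ hmn))

lemma tendsto_gapExp {φ : ℕ → ℝ} (hpos : ∀ n, 0 < φ n)
    (hφ : Filter.Tendsto φ Filter.atTop (nhds 0)) :
    Filter.Tendsto (gapExp φ) Filter.atTop Filter.atTop := by
  refine Filter.tendsto_atTop.mpr fun K => ?_
  filter_upwards [hφ.eventually_lt_const (show (0 : ℝ) < (1 / 3) ^ K by positivity)] with n hn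
  have := (gapExp_spec (hpos n)).trans hn
  exact ((pow_lt_pow_iff_right_of_lt_one₀ (by norm_num) (by norm_num)).mp this).le

lemma finite_setOf_absv_sub_lt (ξ : L3) (m : ℕ) (B : ℝ) :
    {gh : Polynomial F3 × Polynomial F3 | gh.2 ≠ 0 ∧ gh.2.natDegree ≤ m ∧
      absv (ξ - toL gh.1 / toL gh.2) < B}.Finite := by
  obtain ⟨n, hn⟩ := pow_unbounded_of_one_lt (max (absv ξ) B * 3 ^ m) (by norm_num : (1 : ℝ) < 3)
  refine ((finite_setOf_natDegree_le n).prod (finite_setOf_natDegree_le m)).subset ?_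
  rintro ⟨p, q⟩ ⟨hq, hqm, hlt⟩
  refine ⟨?_, hqm⟩
  simp only at hq hqm hlt
  change p.natDegree ≤ n
  by_cases hp : p = 0
  · simp [hp]
  have hdiv : absv (toL p / toL q) ≤ max (absv ξ) B := by
    have := absv_add_le ξ (-(ξ - toL p / toL q))
    rw [absv_neg, show ξ + -(ξ - toL p / toL q) = toL p / toL q by ring] at this
    exact this.trans (max_le_max_left _ hlt.le)
  have hpq : (3 : ℝ) ^ p.natDegree = absv (toL p / toL q) * 3 ^ q.natDegree := by
    rw [← absv_toL hp, ← absv_toL hq, ← absv_mul, div_mul_cancel₀ _ (toL_ne_zero hq)]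
  have hle : (3 : ℝ) ^ p.natDegree < 3 ^ n := by
    refine lt_of_le_of_lt ?_ hn
    rw [hpq]
    exact mul_le_mul hdiv (pow_le_pow_right₀ (by norm_num) hqm) (by positivity)
      ((absv_nonneg _).trans hdiv)
  exact ((pow_lt_pow_iff_right₀ (by norm_num)).mp hle).le

/-- The gaps `d n`, decreased by one at odd places `2 j + 1` with `j ∈ s`. -/
def codedGap (d : ℕ → ℕ) (s : Set ℕ) (k n : ℕ) : ℕ :=
  d n - if k % 2 = 1 ∧ k / 2 ∈ s then 1 else 0

lemma codedGap_even (d : ℕ → ℕ) (s : Set ℕ) (j n : ℕ) : codedGap d s (2 * j) n = d n := by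
  simp [codedGap]

lemma foldExp_codedGap_injective {d : ℕ → ℕ} {n₀ : ℕ} (h₀ : 1 ≤ n₀) (hd : ∀ n, n₀ ≤ n → 2 ≤ d n) :
    Function.Injective fun s : Set ℕ => foldExp n₀ (codedGap d s) := by
  intro s t h
  ext j
  have h1 := congrFun h (2 * j + 1)
  have h2 := congrFun h (2 * j + 1 + 1)
  have h3 := hd _ (le_foldExp (δ := codedGap d t) h₀ (2 * j + 1))
  have h4 : (2 * j + 1) % 2 = 1 := by omega
  have h5 : (2 * j + 1) / 2 = j := by omega
  simp only at h1 h2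
  rw [foldExp.eq_2 _ _ (2 * j + 1), foldExp.eq_2 _ _ (2 * j + 1), h1] at h2
  simp only [codedGap, h4, h5, true_and] at h2 h3
  split_ifs at h2 with hs ht ht <;> first | omega | simp_all

/-- Let `ψ : {3^n} → ℝ₊` be non-increasing with `x ↦ x² ψ(x)`
non-increasing and tending to `0`.  For any `c ∈ (0, 1/3)` the set
`(𝒦(ψ) \ 𝒦(cψ)) ∩ 𝒞` is uncountable.  (Here `ψ n` stands for `ψ(3^n)`.) -/
theorem Kset_diff_uncountable (ψ : ℕ → ℝ) (hpos : ∀ n, 0 < ψ n)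
    (hdec : ∀ m n : ℕ, m ≤ n → ψ n ≤ ψ m)
    (hx2dec : ∀ m n : ℕ, m ≤ n → ((3 : ℝ) ^ n) ^ 2 * ψ n ≤ ((3 : ℝ) ^ m) ^ 2 * ψ m)
    (hx2lim : Filter.Tendsto (fun n : ℕ => ((3 : ℝ) ^ n) ^ 2 * ψ n) Filter.atTop (nhds 0))
    (c : ℝ) (hc0 : 0 < c) (hc : c < 1 / 3) :
    ¬ ((Kset ψ \ Kset (fun n => c * ψ n)) ∩ Cantor).Countable := by
  intro hcount
  set φ : ℕ → ℝ := fun n => ((3 : ℝ) ^ n) ^ 2 * ψ n with hφ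
  have hφpos : ∀ n, 0 < φ n := fun n => mul_pos (by positivity) (hpos n)
  have hdmono := monotone_gapExp hφpos (fun m n h => hx2dec m n h)
  have hdtop := tendsto_gapExp hφpos hx2lim
  set d := gapExp φ with hd
  have hpow : ∀ n e : ℕ, (3 : ℝ) ^ (-(2 * n + e : ℕ) : ℤ) = (1 / 3 : ℝ) ^ e / (3 ^ n) ^ 2 := by
    intro n e
    rw [zpow_neg, zpow_natCast, pow_add, mul_comm 2 n, pow_mul, one_div, inv_pow]
    field_simp
  have hupper : ∀ n, (3 : ℝ) ^ (-(2 * n + d n : ℕ) : ℤ) < ψ n := by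
    intro n
    rw [hpow, div_lt_iff₀ (by positivity), mul_comm]
    exact gapExp_spec (hφpos n)
  have hlower : ∀ n, 1 ≤ d n → c * ψ n < (3 : ℝ) ^ (-(2 * n + d n : ℕ) : ℤ) := by
    intro n hn
    rw [hpow, lt_div_iff₀ (by positivity)]
    have h1 : φ n ≤ (1 / 3 : ℝ) ^ (d n - 1) := le_pow_of_lt_gapExp (Nat.sub_one_lt_of_lt hn)
    have h2 : (1 / 3 : ℝ) ^ d n = (1 / 3 : ℝ) ^ (d n - 1) * (1 / 3) := by
      rw [← pow_succ]; congr 1; omega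
    have h3 : c * φ n < 1 / 3 * φ n := mul_lt_mul_of_pos_right hc (hφpos n)
    have h4 : c * ψ n * ((3 : ℝ) ^ n) ^ 2 = c * φ n := by rw [hφ]; ring
    rw [h2, h4]
    linarith
  obtain ⟨n₁, hn₁⟩ := Filter.eventually_atTop.mp (hdtop.eventually_ge_atTop 2)
  set n₀ := n₁ + 1 with hn₀
  have h₀ : 1 ≤ n₀ := by omega
  have hd2 : ∀ n, n₀ ≤ n → 2 ≤ d n := fun n hn => hn₁ n (by omega)
  obtain ⟨m₀, hm₀⟩ := Filter.eventually_atTop.mp (hdtop.eventually_ge_atTop n₀)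
  let D : ℕ → ℕ := fun n => max (d n) n₀
  have hD : Monotone D := hdmono.max monotone_const
  have hδ : ∀ s k n, n₀ ≤ n → 1 ≤ codedGap d s k n ∧ codedGap d s k n ≤ D n := by
    intro s k n hn
    have h1 := hd2 n hn
    have h2 : d n ≤ D n := le_max_left _ _
    unfold codedGap
    split_ifs <;> omega
  let ξ : Set ℕ → L3 := fun s => indicatorSeries (foldExp n₀ (codedGap d s))
  have hξinj : Function.Injective ξ := fun s t h =>
    foldExp_codedGap_injective h₀ hd2
      (indicatorSeries_injOn (strictMono_foldExp h₀) (strictMono_foldExp h₀) h)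
  have hmem : ∀ s, ξ s ∈ (Kset ψ \ Kset (fun n => c * ψ n)) ∩ Cantor := by
    intro s
    have hmono := strictMono_foldExp (δ := codedGap d s) h₀
    have hC : ξ s ∈ Cantor :=
      indicatorSeries_mem_Cantor fun k => h₀.trans (le_foldExp h₀ k)
    refine ⟨⟨⟨Cantor_subset_unitBall hC, ?_⟩, fun hK => hK.2 ?_⟩, hC⟩
    · refine Set.infinite_of_injective_forall_mem (f := fun j : ℕ =>
        (foldNum n₀ (codedGap d s) (2 * j),
          (Polynomial.X : Polynomial F3) ^ foldExp n₀ (codedGap d s) (2 * j))) ?_ ?_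
      · intro i j hij
        have h := congrArg Polynomial.natDegree (Prod.ext_iff.mp hij).2
        simp only [Polynomial.natDegree_X_pow] at h
        have := hmono.injective h
        omega
      · intro j
        refine ⟨pow_ne_zero _ Polynomial.X_ne_zero, ?_⟩
        have hX : ∀ n, toL (Polynomial.X ^ n) = XL ^ n := fun n => by simp [toL]
        rw [Polynomial.natDegree_X_pow, hX, absv_indicatorSeries_sub h₀, foldExp, codedGap_even]
        exact hupper _
    · refine (finite_setOf_absv_sub_lt (ξ s) m₀ (c * ψ 0)).subset ?_
      rintro ⟨p, q⟩ ⟨hq, hlt⟩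
      simp only at hq hlt
      refine ⟨hq, ?_, hlt.trans_le (mul_le_mul_of_nonneg_left (hdec 0 _ (Nat.zero_le _)) hc0.le)⟩
      by_contra! hm
      simp only at hm
      have h1 := le_absv_indicatorSeries_sub hD h₀ (fun m => le_max_right _ _) (hδ s) p hq
      have h2 := hm₀ _ hm.le
      have h3 : D q.natDegree = d q.natDegree := max_eq_left h2
      rw [h3] at h1
      exact absurd (h1.trans_lt hlt) (hlower _ (by omega)).le.not_gt
  have hcS : Countable (Set ℕ) := by
    have : Countable ↥((Kset ψ \ Kset (fun n => c * ψ n)) ∩ Cantor) := hcount.to_subtype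
    exact Function.Injective.countable (f := fun s => (⟨ξ s, hmem s⟩ :
      ↥((Kset ψ \ Kset (fun n => c * ψ n)) ∩ Cantor)))
      fun s t h => hξinj (Subtype.ext_iff.mp h)
  obtain ⟨f, hf⟩ := hcS.exists_injective_nat
  exact Function.cantor_injective f hf
end
end

section
/- Let ψ : {3^n : n ∈ ℕ} → {3^{-r} : r ∈ ℤ}, and suppose ψ(3^n) ≤ 3^{-n} for all n ∈ ℕ. Then the sum of μ(A*_n) over all n ∈ ℕ satisfies: if ∑_{n=1}^∞ (ψ(3ⁿ) · 3ⁿ)^γ = ∞, then ∑_{n=1}^∞ μ(A*_n) = ∞. -/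
/-!
Setting: `𝔽₃((X⁻¹))`, the field of formal Laurent series over the field `𝔽₃` with `3` elements,
with absolute value `|f| = 3^N` when `f = ∑_{n ≥ -N} a_{-n} X^{-n}` with `a_N ≠ 0`, `|0| = 0`.
We model it as `LaurentSeries (ZMod 3)` in the variable `t = X⁻¹`, so the coefficient
`a_{-n}` of `X^{-n}` is the coefficient of `t^n`, and `|f| = 3^{-ord_t f}`.
-/

noncomputable section
open scoped ENNReal Classical

open MeasureTheory

theorem absv_lt_zpow_iff (f : L3) (k : ℤ) :
    absv f < (3 : ℝ) ^ k ↔ ∀ m ≤ -k, f.coeff m = 0 := by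
  by_cases hf : f = 0
  · simp only [absv, hf, if_true, HahnSeries.coeff_zero, implies_true, iff_true]
    positivity
  · rw [absv, if_neg hf, zpow_lt_zpow_iff_right₀ (by norm_num)]
    constructor
    · intro h m hm
      exact HahnSeries.coeff_eq_zero_of_lt_order (by omega)
    · intro h
      by_contra! hk
      exact HahnSeries.coeff_order_eq_zero.not.mpr hf (h _ (by omega))

theorem mem_ball_zpow_iff (x y : L3) (k : ℤ) :
    y ∈ ball x ((3 : ℝ) ^ k) ↔ ∀ m ≤ -k, y.coeff m = x.coeff m := by
  simp only [ball, Set.mem_ofPred_eq, absv_lt_zpow_iff, HahnSeries.coeff_sub, sub_eq_zero]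

theorem three_zpow_rpow_gam (k : ℤ) : ((3 : ℝ) ^ k) ^ gam = 2 ^ k := by
  have h3 : (3 : ℝ) ^ gam = 2 := by
    rw [gam, Real.log_div_log]
    exact Real.rpow_logb (by norm_num) (by norm_num) (by norm_num)
  rw [← Real.rpow_intCast, ← Real.rpow_mul (by norm_num), mul_comm,
    Real.rpow_mul (by norm_num), h3, Real.rpow_intCast]

/-- The digit in `{0, 2}` encoded by a bit. -/
def digit (b : Bool) : F3 := bif b then 2 else 0

theorem digit_eq (b : Bool) : digit b = 0 ∨ digit b = 2 := by
  cases b <;> simp [digit]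

/-- The point of the Cantor set whose coefficient of `X^{-(i+1)}` is encoded by `b i`. -/
def cantorPoint (b : ℕ → Bool) : L3 :=
  HahnSeries.ofSuppBddBelow (fun m : ℤ => if 1 ≤ m then digit (b (m - 1).toNat) else 0)
    ⟨1, fun m hm => by
      by_contra h
      exact hm (if_neg h)⟩

theorem coeff_cantorPoint (b : ℕ → Bool) (m : ℤ) :
    (cantorPoint b).coeff m = if 1 ≤ m then digit (b (m - 1).toNat) else 0 := rfl

theorem cantorPoint_mem_Cantor (b : ℕ → Bool) : cantorPoint b ∈ Cantor := by
  constructor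
  · intro m hm
    rw [coeff_cantorPoint, if_neg (by omega)]
  · intro m hm
    rw [coeff_cantorPoint, if_pos hm]
    exact digit_eq _

/-- The fair coin-tossing measure on bit sequences. -/
def coinMeasure : Measure (ℕ → Bool) :=
  Measure.infinitePi fun _ => (PMF.uniformOfFintype Bool).toMeasure

instance : IsProbabilityMeasure coinMeasure := by
  unfold coinMeasure
  infer_instance

theorem coinMeasure_cylinder (s : Finset ℕ) (c : ℕ → Bool) :
    coinMeasure {b | ∀ i ∈ s, b i = c i} = 2⁻¹ ^ s.card := by
  have h : {b : ℕ → Bool | ∀ i ∈ s, b i = c i} = Set.pi s fun i => {c i} := by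
    ext b
    simp [Set.mem_pi]
  rw [h, coinMeasure, Measure.infinitePi_pi _ fun i _ => measurableSet_singleton _]
  simp

theorem coinMeasure_preimage_ball_le (x : L3) (k : ℤ) :
    coinMeasure (cantorPoint ⁻¹' ball x ((3 : ℝ) ^ k)) ≤
      ENNReal.ofReal (((3 : ℝ) ^ k) ^ gam) := by
  rw [three_zpow_rpow_gam]
  by_cases hk : 0 ≤ k
  · refine prob_le_one.trans ?_
    rw [ENNReal.one_le_ofReal]
    exact one_le_zpow₀ (by norm_num) hk
  · obtain ⟨r, rfl⟩ : ∃ r : ℕ, k = -(r : ℤ) := ⟨k.natAbs, by omega⟩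
    calc coinMeasure (cantorPoint ⁻¹' ball x ((3 : ℝ) ^ (-(r : ℤ))))
        ≤ coinMeasure {b | ∀ i ∈ Finset.range r, b i = decide (x.coeff (i + 1) = 2)} := by
          refine measure_mono fun b hb i hi => ?_
          rw [Set.mem_preimage, mem_ball_zpow_iff] at hb
          have h := hb (i + 1) (by simp at hi; omega)
          rw [coeff_cantorPoint, if_pos (by omega)] at h
          rw [← h]
          simp only [add_sub_cancel_right, Int.toNat_natCast]
          cases b i <;> decide
      _ = 2⁻¹ ^ r := by rw [coinMeasure_cylinder, Finset.card_range]
      _ ≤ ENNReal.ofReal (2 ^ (-(r : ℤ))) := by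
          rw [zpow_neg, zpow_natCast, ENNReal.ofReal_inv_of_pos (by positivity),
            ENNReal.ofReal_pow (by norm_num), ENNReal.inv_pow]
          simp

theorem coinMeasure_preimage_le_mu (A : Set L3) : coinMeasure (cantorPoint ⁻¹' A) ≤ mu A := by
  rw [mu, hgamma, hmeas]
  refine le_iSup₂_of_le 1 one_pos (le_iInf fun S => le_iInf fun hS => le_iInf fun _ =>
    le_iInf fun hcov => ?_)
  have : Countable S := hS.to_subtype
  calc coinMeasure (cantorPoint ⁻¹' A)
      ≤ coinMeasure (⋃ p : S, cantorPoint ⁻¹' ball p.1.1 ((3 : ℝ) ^ p.1.2)) := by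
        refine measure_mono fun b hb => ?_
        simpa using hcov ⟨hb, cantorPoint_mem_Cantor b⟩
    _ ≤ ∑' p : S, coinMeasure (cantorPoint ⁻¹' ball p.1.1 ((3 : ℝ) ^ p.1.2)) :=
        measure_iUnion_le _
    _ ≤ _ := ENNReal.tsum_le_tsum fun p => coinMeasure_preimage_ball_le _ _

theorem coeff_toL_div_XL_pow (n : ℕ) (c : ℕ → F3) (m : ℤ) :
    (toL (∑ k ∈ Finset.range n, Polynomial.monomial k (c k)) / XL ^ n).coeff m =
      if 1 ≤ m ∧ m ≤ n then c (n - m).toNat else 0 := by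
  have h : toL (∑ k ∈ Finset.range n, Polynomial.monomial k (c k)) / XL ^ n =
      ∑ k ∈ Finset.range n, HahnSeries.single ((n : ℤ) - k) (c k) := by
    rw [div_eq_mul_inv, toL, map_sum, Finset.sum_mul]
    refine Finset.sum_congr rfl fun k _ => ?_
    have halg : algebraMap F3 L3 (c k) = HahnSeries.single 0 (c k) := by
      rw [HahnSeries.algebraMap_apply', PowerSeries.algebraMap_apply, HahnSeries.ofPowerSeries_C]
      rfl
    rw [Polynomial.aeval_monomial, XL, HahnSeries.single_pow, HahnSeries.single_pow,
      HahnSeries.inv_single, halg, HahnSeries.single_mul_single, HahnSeries.single_mul_single]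
    simp only [one_pow, inv_one, mul_one, nsmul_eq_mul]
    rw [show 0 + (k : ℤ) * -1 + -(n * -1) = n - k by ring]
  rw [h, HahnSeries.coeff_sum]
  split_ifs with hm
  · rw [Finset.sum_eq_single (n - m).toNat]
    · rw [Int.toNat_of_nonneg (by omega), sub_sub_cancel, HahnSeries.coeff_single_same]
    · intro k _ hk
      exact HahnSeries.coeff_single_of_ne (by omega)
    · intro hk
      simp at hk
      omega
  · refine Finset.sum_eq_zero fun k hk => HahnSeries.coeff_single_of_ne ?_
    simp at hk
    omega

theorem cantorPoint_mem_Astar {ψ : ℕ → ℝ} {n d : ℕ}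
    (hψ : ψ (n + 1) = (3 : ℝ) ^ (-((n + 1 + d : ℕ) : ℤ))) {b : ℕ → Bool} (hbn : b n = true)
    (hb : ∀ i, n < i → i < n + 1 + d → b i = false) : cantorPoint b ∈ Astar ψ (n + 1) := by
  have hcoeff : ∀ j, (∑ k ∈ Finset.range (n + 1),
      Polynomial.monomial k (digit (b (n - k)))).coeff j =
        if j < n + 1 then digit (b (n - j)) else 0 := by
    intro j
    simp [Polynomial.finsetSum_coeff, Polynomial.coeff_monomial]
  refine Set.mem_iUnion₂.mpr ⟨∑ k ∈ Finset.range (n + 1),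
    Polynomial.monomial k (digit (b (n - k))), ⟨?_, ?_, ?_⟩, ?_⟩
  · rw [Polynomial.degree_lt_iff_coeff_zero]
    intro j hj
    rw [hcoeff, if_neg (by omega)]
  · intro k hk
    rw [hcoeff, if_pos hk]
    exact digit_eq _
  · rw [hcoeff, if_pos (by omega), Nat.sub_zero, hbn]
    rfl
  · rw [hψ, mem_ball_zpow_iff]
    intro m hm
    rw [coeff_toL_div_XL_pow _ fun k => digit (b (n - k)), coeff_cantorPoint]
    by_cases h1 : 1 ≤ m
    · by_cases h2 : m ≤ (n + 1 : ℕ)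
      · rw [if_pos h1, if_pos ⟨h1, h2⟩]
        congr 2
        omega
      · rw [if_pos h1, if_neg (by tauto), hb _ (by omega) (by omega)]
        rfl
    · rw [if_neg h1, if_neg (by tauto)]

theorem half_mul_le_mu_Astar {ψ : ℕ → ℝ} {n : ℕ} (hψ : ∃ r : ℤ, ψ (n + 1) = (3 : ℝ) ^ (-r))
    (hle : ψ (n + 1) ≤ (3 : ℝ) ^ (-((n + 1 : ℕ) : ℤ))) :
    2⁻¹ * ENNReal.ofReal ((ψ (n + 1) * (3 : ℝ) ^ (n + 1)) ^ gam) ≤ mu (Astar ψ (n + 1)) := by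
  obtain ⟨r, hr⟩ := hψ
  rw [hr, zpow_le_zpow_iff_right₀ (by norm_num)] at hle
  obtain ⟨d, rfl⟩ : ∃ d : ℕ, r = (n + 1 + d : ℕ) := ⟨(r - (n + 1)).toNat, by omega⟩
  have hpow : (3 : ℝ) ^ (-((n + 1 + d : ℕ) : ℤ)) * 3 ^ (n + 1) = 3 ^ (-(d : ℤ)) := by
    rw [← zpow_natCast, ← zpow_add₀ (by norm_num)]
    congr 1
    push_cast
    ring
  calc 2⁻¹ * ENNReal.ofReal ((ψ (n + 1) * (3 : ℝ) ^ (n + 1)) ^ gam)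
      = 2⁻¹ ^ (Finset.Ico n (n + 1 + d)).card := by
        rw [hr, hpow, three_zpow_rpow_gam, zpow_neg, zpow_natCast,
          ENNReal.ofReal_inv_of_pos (by positivity), ENNReal.ofReal_pow (by norm_num),
          Nat.card_Ico, show n + 1 + d - n = d + 1 by omega, pow_succ', ENNReal.inv_pow]
        simp
    _ = coinMeasure {b | ∀ i ∈ Finset.Ico n (n + 1 + d), b i = decide (i = n)} :=
        (coinMeasure_cylinder _ _).symm
    _ ≤ coinMeasure (cantorPoint ⁻¹' Astar ψ (n + 1)) := by
        refine measure_mono fun b hb => cantorPoint_mem_Astar hr ?_ fun i h1 h2 => ?_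
        · simpa using hb n (by simp; omega)
        · simpa [h1.ne'] using hb i (by simp; omega)
    _ ≤ mu (Astar ψ (n + 1)) := coinMeasure_preimage_le_mu _

/-- Assume `ψ(3^n) ≤ 3^{-n}` for all `n`.  If
`∑_{n ≥ 1} (ψ(3ⁿ) · 3ⁿ)^γ = ∞`, then `∑_{n ≥ 1} μ(A*_n) = ∞`. -/
theorem sum_mu_Astar_divergent (ψ : ℕ → ℝ)
    (hψ : ∀ n : ℕ, 1 ≤ n → ∃ r : ℤ, ψ n = (3 : ℝ) ^ (-r))
    (hle : ∀ n : ℕ, 1 ≤ n → ψ n ≤ (3 : ℝ) ^ (-(n : ℤ)))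
    (hdiv : ∑' n : ℕ, ENNReal.ofReal ((ψ (n + 1) * (3 : ℝ) ^ (n + 1)) ^ gam) = ⊤) :
    ∑' n : ℕ, mu (Astar ψ (n + 1)) = ⊤ := by
  refine top_unique ?_
  calc ⊤ = 2⁻¹ * ∑' n : ℕ, ENNReal.ofReal ((ψ (n + 1) * (3 : ℝ) ^ (n + 1)) ^ gam) := by
        rw [hdiv, ENNReal.mul_top (by simp)]
    _ = ∑' n : ℕ, 2⁻¹ * ENNReal.ofReal ((ψ (n + 1) * (3 : ℝ) ^ (n + 1)) ^ gam) :=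
        ENNReal.tsum_mul_left.symm
    _ ≤ ∑' n : ℕ, mu (Astar ψ (n + 1)) := ENNReal.tsum_le_tsum fun n =>
        half_mul_le_mu_Astar (hψ _ (by omega)) (hle _ (by omega))
end
end
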